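/- Let d, m ≥ 1, r⃗ ∈ (0,∞)^m, q ∈ (0,∞), s ∈ (q,∞], and set ρ := (1/q − 1/s)^{-1}. Let (Ω,μ) be a σ-finite measure space, let t⃗ ∈ (0,∞]^m with 1/t := ∑_{j=1}^m 1/t_j satisfying q ≤ t < ∞, and define u ∈ (0,∞] by 1/u := 1/q − 1/t. Let f_j : ℝ^d × Ω → ℂ (1 ≤ j ≤ m) be jointly measurable with ‖f_j(x,·)‖_{L^{t_j}(Ω)} locally r_j-integrable in x, let F : ℝ^d × Ω → ℂ be jointly measurable with F(x,·) ∈ L^t(Ω) for a.e. x, and let C ≥ 0. Then the following are equivalent: (i) for every jointly measurable g : ℝ^d × Ω → ℂ, bounded and supported in a bounded x-set, with g(x,·) ∈ L^u(Ω) for a.e. x: (∫_{ℝ^d} ∫_Ω |F(x,ω)|^q |g(x,ω)|^q dμ(ω) dx)^{1/q} ≤ C ‖M_{(r_1,…,r_m,ρ)}(‖f_1(·,·)‖_{L^{t_1}(Ω)},…,‖f_m(·,·)‖_{L^{t_m}(Ω)}, ‖g(·,·)‖_{L^u(Ω)})‖_{L^q(ℝ^d)}; (ii) for every g ∈ L^∞_c(ℝ^d):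 ‖ ‖F(x,·)‖_{L^t(Ω)} · g(x) ‖_{L^q(ℝ^d,dx)} ≤ C ‖M_{(r_1,…,r_m,ρ)}(‖f_1(·,·)‖_{L^{t_1}(Ω)},…,‖f_m(·,·)‖_{L^{t_m}(Ω)}, g)‖_{L^q(ℝ^d)}. -/

import Mathlib

open MeasureTheory ENNReal

noncomputable section

structure Cube (d : ℕ) where
  corner : Fin d → ℝ
  side : ℝ
  side_pos : 0 < side

namespace Cube
def set {d : ℕ} (Q : Cube d) : Set (Fin d → ℝ) :=
  {x | ∀ i, Q.corner i ≤ x i ∧ x i < Q.corner i + Q.side}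
def vol {d : ℕ} (Q : Cube d) : ℝ≥0∞ := volume Q.set
def IsDyadic {d : ℕ} (Q : Cube d) : Prop :=
  ∃ (k : ℤ) (n : Fin d → ℤ), Q.side = (2:ℝ) ^ (-k) ∧ ∀ i, Q.corner i = (2:ℝ) ^ (-k) * (n i : ℝ)
end Cube

def IsSparse {d : ℕ} (S : Set (Cube d)) : Prop :=
  ∃ E : Cube d → Set (Fin d → ℝ),
    (∀ Q ∈ S, MeasurableSet (E Q) ∧ E Q ⊆ Q.set ∧ Q.vol ≤ 2 * volume (E Q)) ∧
    S.PairwiseDisjoint E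

def eNorm {α : Type*} [MeasurableSpace α] (p : ℝ≥0∞) (μ : Measure α) (F : α → ℝ≥0∞) : ℝ≥0∞ :=
  if p = ∞ then essSup F μ else (∫⁻ x, F x ^ p.toReal ∂μ) ^ (1 / p.toReal)

def nn {α : Type*} (f : α → ℂ) : α → ℝ≥0∞ := fun x => (‖f x‖₊ : ℝ≥0∞)

def avg {d : ℕ} (r : ℝ≥0∞) (F : (Fin d → ℝ) → ℝ≥0∞) (Q : Cube d) : ℝ≥0∞ :=
  if r = ∞ then essSup F (volume.restrict Q.set)
  else ((∫⁻ x in Q.set, F x ^ r.toReal) / Q.vol) ^ (1 / r.toReal)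

def maximal {d k : ℕ} (r : Fin k → ℝ≥0∞) (F : Fin k → (Fin d → ℝ) → ℝ≥0∞)
    (x : Fin d → ℝ) : ℝ≥0∞ :=
  ⨆ (Q : Cube d) (_ : x ∈ Q.set), ∏ j, avg (r j) (F j) Q

def maximalX {d k : ℕ} (r : Fin k → ℝ≥0∞) (ρ : ℝ≥0∞) (F : Fin k → (Fin d → ℝ) → ℝ≥0∞)
    (G : (Fin d → ℝ) → ℝ≥0∞) (x : Fin d → ℝ) : ℝ≥0∞ :=
  ⨆ (Q : Cube d) (_ : x ∈ Q.set), (∏ j, avg (r j) (F j) Q) * avg ρ G Q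

def wNorm {d : ℕ} (p : ℝ≥0∞) (w : (Fin d → ℝ) → ℝ) (F : (Fin d → ℝ) → ℝ≥0∞) : ℝ≥0∞ :=
  eNorm p volume (fun x => F x * ENNReal.ofReal (w x))

def aConst {d m : ℕ} (p r : Fin m → ℝ≥0∞) (s : ℝ≥0∞)
    (w : Fin m → (Fin d → ℝ) → ℝ) : ℝ≥0∞ :=
  ⨆ Q : Cube d,
    (∏ j, avg ((r j)⁻¹ - (p j)⁻¹)⁻¹ (fun x => ENNReal.ofReal (w j x)⁻¹) Q) *
      avg ((∑ j, (p j)⁻¹) - s⁻¹)⁻¹ (fun x => ENNReal.ofReal (∏ j, w j x)) Q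

def latAvg {d : ℕ} {Ω : Type*} (r : ℝ≥0∞) (f : (Fin d → ℝ) → Ω → ℂ) (Q : Cube d) (ω : Ω) : ℝ≥0∞ :=
  ((∫⁻ y in Q.set, (‖f y ω‖₊ : ℝ≥0∞) ^ r.toReal) / Q.vol) ^ (1 / r.toReal)

def latMax {d m : ℕ} {Ω : Type*} (r : Fin m → ℝ≥0∞) (D : Finset (Cube d))
    (f : Fin m → (Fin d → ℝ) → Ω → ℂ) (x : Fin d → ℝ) (ω : Ω) : ℝ≥0∞ :=
  ⨆ Q ∈ D, ⨆ (_ : x ∈ Cube.set Q), ∏ j, latAvg (r j) (f j) Q ω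

def latMaxX {d m : ℕ} {Ω : Type*} (r : Fin m → ℝ≥0∞) (ρ : ℝ≥0∞) (D : Finset (Cube d))
    (f : Fin m → (Fin d → ℝ) → Ω → ℂ) (g : (Fin d → ℝ) → Ω → ℂ)
    (x : Fin d → ℝ) (ω : Ω) : ℝ≥0∞ :=
  ⨆ Q ∈ D, ⨆ (_ : x ∈ Cube.set Q), (∏ j, latAvg (r j) (f j) Q ω) * latAvg ρ g Q ω

def MemLinftyC {d : ℕ} (f : (Fin d → ℝ) → ℂ) : Prop :=
  Measurable f ∧ (∃ M : ℝ, ∀ x, ‖f x‖ ≤ M) ∧ Bornology.IsBounded (Function.support f)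

def SimpleLinftyC {d : ℕ} (f : (Fin d → ℝ) → ℂ) : Prop :=
  Measurable f ∧ (Set.range f).Finite ∧ Bornology.IsBounded (Function.support f)

def PairSimple {d : ℕ} {Ω : Type*} [MeasurableSpace Ω] (f : (Fin d → ℝ) → Ω → ℂ) : Prop :=
  Measurable (Function.uncurry f) ∧ (Set.range (Function.uncurry f)).Finite ∧
    ∃ B : Set (Fin d → ℝ), Bornology.IsBounded B ∧ ∀ x ∉ B, ∀ ω, f x ω = 0

def VecSimple {d : ℕ} {Ω : Type*} [MeasurableSpace Ω] (f : (Fin d → ℝ) → Ω → ℂ) : Prop :=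
  ∃ (N : ℕ) (A : Fin N → Set (Fin d → ℝ)) (ξ : Fin N → Ω → ℂ),
    (∀ i, MeasurableSet (A i)) ∧ (∀ i, Bornology.IsBounded (A i)) ∧
    (∀ i, Measurable (ξ i)) ∧ (∃ M : ℝ, ∀ i ω, ‖ξ i ω‖ ≤ M) ∧
    ∀ x ω, f x ω = ∑ i, (A i).indicator (fun _ => ξ i ω) x

lemma eNorm_eq_eLpNorm {α : Type*} [MeasurableSpace α] {p : ℝ≥0∞} (hp : p ≠ 0) (μ : Measure α)
    (f : α → ℂ) : eNorm p μ (nn f) = eLpNorm f p μ := by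
  unfold eNorm
  split_ifs with h
  · subst h
    rw [eLpNorm_exponent_top]
    rfl
  · rw [eLpNorm_eq_lintegral_rpow_enorm_toReal hp h]
    rfl

lemma eNorm_mono {α : Type*} [MeasurableSpace α] (p : ℝ≥0∞) (μ : Measure α)
    {F G : α → ℝ≥0∞} (h : ∀ x, F x ≤ G x) : eNorm p μ F ≤ eNorm p μ G := by
  unfold eNorm
  split_ifs with hp
  · exact essSup_mono_ae (Filter.Eventually.of_forall h)
  · refine ENNReal.rpow_le_rpow (lintegral_mono fun x => ?_) (by positivity)
    exact ENNReal.rpow_le_rpow (h x) (by positivity)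

lemma avg_mono {d : ℕ} (r : ℝ≥0∞) {F G : (Fin d → ℝ) → ℝ≥0∞} (h : ∀ x, F x ≤ G x) (Q : Cube d) :
    avg r F Q ≤ avg r G Q := by
  unfold avg
  split_ifs with hp
  · exact essSup_mono_ae (Filter.Eventually.of_forall h)
  · refine ENNReal.rpow_le_rpow (ENNReal.div_le_div_right (lintegral_mono fun x => ?_) _)
      (by positivity)
    exact ENNReal.rpow_le_rpow (h x) (by positivity)

lemma maximalX_mono {d k : ℕ} (r : Fin k → ℝ≥0∞) (ρ : ℝ≥0∞) (F : Fin k → (Fin d → ℝ) → ℝ≥0∞)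
    {G H : (Fin d → ℝ) → ℝ≥0∞} (h : ∀ x, G x ≤ H x) (x : Fin d → ℝ) :
    maximalX r ρ F G x ≤ maximalX r ρ F H x := by
  unfold maximalX
  exact iSup_mono fun Q => iSup_mono fun _ => mul_le_mul_right (avg_mono ρ h Q) _

lemma measurable_eNorm {X Ω : Type*} [MeasurableSpace X] [MeasurableSpace Ω] (μ : Measure Ω)
    [SigmaFinite μ] (p : ℝ≥0∞) (g : X → Ω → ℂ) (hg : Measurable (Function.uncurry g)) :
    Measurable (fun x => eNorm p μ (nn (g x))) := by
  have hn : Measurable (fun z : X × Ω => (‖g z.1 z.2‖₊ : ℝ≥0∞)) := hg.enorm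
  unfold eNorm
  split_ifs with hp
  · refine measurable_of_Iic fun a => ?_
    have hS : MeasurableSet {z : X × Ω | a < (‖g z.1 z.2‖₊ : ℝ≥0∞)} :=
      measurableSet_lt measurable_const hn
    have hm := measurable_measure_prodMk_left (ν := μ) hS
    have : (fun x => essSup (nn (g x)) μ) ⁻¹' Set.Iic a =
        (fun x => μ (Prod.mk x ⁻¹' {z : X × Ω | a < (‖g z.1 z.2‖₊ : ℝ≥0∞)})) ⁻¹' {0} := by
      ext x
      simp only [Set.mem_preimage, Set.mem_Iic, Set.mem_singleton_iff]
      constructor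
      · intro h
        have h1 : ∀ᵐ ω ∂μ, nn (g x) ω ≤ a := by
          filter_upwards [ENNReal.ae_le_essSup (μ := μ) (nn (g x))] with ω hω using hω.trans h
        rw [ae_iff] at h1
        simpa [nn] using h1
      · intro h
        refine essSup_le_of_ae_le a ?_
        change ∀ᵐ ω ∂μ, nn (g x) ω ≤ a
        rw [ae_iff]
        simpa [nn] using h
    rw [this]
    exact hm (measurableSet_singleton 0)
  · have : Measurable (fun z : X × Ω => (‖g z.1 z.2‖₊ : ℝ≥0∞) ^ p.toReal) := hn.pow_const _
    exact (this.lintegral_prod_right').pow_const _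

lemma holder_aux {Ω : Type*} [MeasurableSpace Ω] (μ : Measure Ω) (q T U : ℝ≥0∞) (hq : q ≠ 0)
    (hq' : q ≠ ∞) (hT : T ≠ 0) (hU : U ≠ 0) (h : T⁻¹ + U⁻¹ = q⁻¹) (f g : Ω → ℂ)
    (hf : Measurable f) (hg : Measurable g) :
    ∫⁻ ω, (‖f ω‖₊ : ℝ≥0∞) ^ q.toReal * (‖g ω‖₊ : ℝ≥0∞) ^ q.toReal ∂μ ≤
      (eNorm T μ (nn f) * eNorm U μ (nn g)) ^ q.toReal := by
  have hq0 : 0 < q.toReal := ENNReal.toReal_pos hq hq'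
  have : ENNReal.HolderTriple T U q := ⟨h⟩
  have := eLpNorm_smul_le_mul_eLpNorm (p := T) (q := U) (r := q) (μ := μ)
    hg.aestronglyMeasurable hf.aestronglyMeasurable
  rw [← eNorm_eq_eLpNorm hT, ← eNorm_eq_eLpNorm hU, ← eNorm_eq_eLpNorm hq] at this
  have h2 := ENNReal.rpow_le_rpow this hq0.le
  refine le_trans (le_of_eq ?_) h2
  rw [eNorm, if_neg hq', ← ENNReal.rpow_mul, one_div, inv_mul_cancel₀ hq0.ne', ENNReal.rpow_one]
  refine lintegral_congr fun ω => ?_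
  rw [← ENNReal.mul_rpow_of_nonneg _ _ hq0.le]
  simp [nn]

lemma key1 {Ω : Type*} [MeasurableSpace Ω] (μ : Measure Ω) (φ : Ω → ℝ≥0∞) (hφ : Measurable φ)
    (q t : ℝ) (hq : 0 < q) (hqt : q ≤ t) (N : ℝ≥0∞)
    (hN : N = (∫⁻ ω, φ ω ^ t ∂μ) ^ (1 / t)) (hfin : N ≠ ∞) :
    ∫⁻ ω, φ ω ^ q * (φ ω ^ ((t - q) / q) / N ^ ((t - q) / q)) ^ q ∂μ = N ^ q := by
  have ht : 0 < t := hq.trans_le hqt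
  have hNt : N ^ t = ∫⁻ ω, φ ω ^ t ∂μ := by
    rw [hN, ← ENNReal.rpow_mul, one_div, inv_mul_cancel₀ ht.ne', ENNReal.rpow_one]
  rcases eq_or_ne N 0 with h0 | h0
  · rw [h0, ENNReal.zero_rpow_of_pos ht] at hNt
    have h1 := (lintegral_eq_zero_iff (hφ.pow_const t)).1 hNt.symm
    rw [h0, ENNReal.zero_rpow_of_pos hq, lintegral_eq_zero_iff' (by fun_prop)]
    filter_upwards [h1] with ω hω
    have : φ ω = 0 := by
      have := (ENNReal.rpow_eq_zero_iff_of_pos ht).1 hω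
      exact this
    simp [this, ENNReal.zero_rpow_of_pos hq]
  · have ha : 0 ≤ (t - q) / q := div_nonneg (by linarith) hq.le
    have : ∀ ω, φ ω ^ q * (φ ω ^ ((t - q) / q) / N ^ ((t - q) / q)) ^ q =
        φ ω ^ t * N ^ (q - t) := by
      intro ω
      rw [ENNReal.div_rpow_of_nonneg _ _ hq.le, ← ENNReal.rpow_mul, ← ENNReal.rpow_mul,
        div_mul_cancel₀ _ hq.ne', div_eq_mul_inv, ← mul_assoc,
        ← ENNReal.rpow_add_of_nonneg _ _ hq.le (by linarith), ← ENNReal.rpow_neg]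
      congr 2 <;> ring
    simp_rw [this]
    rw [lintegral_mul_const _ (hφ.pow_const t), ← hNt, ← ENNReal.rpow_add _ _ h0 hfin]
    congr 1; ring

lemma key2 {Ω : Type*} [MeasurableSpace Ω] (μ : Measure Ω) (φ : Ω → ℝ≥0∞) (hφ : Measurable φ)
    (q t u : ℝ) (hq : 0 < q) (hqt : q < t) (hu : 0 < u) (hutq : (t - q) / q * u = t) (N : ℝ≥0∞)
    (hN : N = (∫⁻ ω, φ ω ^ t ∂μ) ^ (1 / t)) :
    ∫⁻ ω, (φ ω ^ ((t - q) / q) / N ^ ((t - q) / q)) ^ u ∂μ ≤ 1 := by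
  have ht : 0 < t := hq.trans hqt
  have ha : 0 < (t - q) / q := div_pos (by linarith) hq
  have hNt : N ^ t = ∫⁻ ω, φ ω ^ t ∂μ := by
    rw [hN, ← ENNReal.rpow_mul, one_div, inv_mul_cancel₀ ht.ne', ENNReal.rpow_one]
  have : ∀ ω, (φ ω ^ ((t - q) / q) / N ^ ((t - q) / q)) ^ u =
        φ ω ^ t * (N ^ t)⁻¹ := by
    intro ω
    rw [ENNReal.div_rpow_of_nonneg _ _ hu.le, ← ENNReal.rpow_mul, ← ENNReal.rpow_mul,
        hutq, div_eq_mul_inv]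
  simp_rw [this]
  rw [lintegral_mul_const _ (hφ.pow_const t), ← hNt]
  exact ENNReal.mul_inv_le_one _

lemma iSup_trunc (A G : ℝ≥0∞) (q : ℝ) (hq : 0 < q) :
    ⨆ n : ℕ, (A * min G n) ^ q = (A * G) ^ q := by
  have h := (ENNReal.orderIsoRpow q hq).map_iSup (fun n : ℕ => A * min G n)
  simp only [ENNReal.orderIsoRpow_apply] at h
  rw [← h, ← ENNReal.mul_iSup]
  congr 2
  have : ⨆ n : ℕ, G ⊓ (n : ℝ≥0∞) = G := by
    rw [← inf_iSup_eq, ENNReal.iSup_natCast, inf_top_eq]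
  exact this

lemma mono_trunc (A G : ℝ≥0∞) (q : ℝ) (hq : 0 < q) :
    Monotone fun n : ℕ => (A * min G n) ^ q := by
  intro a b hab
  refine ENNReal.rpow_le_rpow (mul_le_mul_right (min_le_min le_rfl ?_) _) hq.le
  exact_mod_cast hab

lemma lintegral_trunc_le {X : Type*} [MeasurableSpace X] (ν : Measure X) (A G : X → ℝ≥0∞)
    (hA : Measurable A) (hG : Measurable G) (q : ℝ) (hq : 0 < q) (K : ℝ≥0∞)
    (h : ∀ n : ℕ, ∫⁻ x, (A x * min (G x) n) ^ q ∂ν ≤ K) : ∫⁻ x, (A x * G x) ^ q ∂ν ≤ K := by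
  have e : ∀ x, (A x * G x) ^ q = ⨆ n : ℕ, (A x * min (G x) n) ^ q :=
    fun x => (iSup_trunc _ _ q hq).symm
  rw [lintegral_congr e, lintegral_iSup (fun n => by fun_prop)
    (fun a b hab x => mono_trunc (A x) (G x) q hq hab)]
  exact iSup_le h

lemma nn_trunc (z : ℂ) (h : ℝ≥0∞) (n : ℕ) :
    (‖z * (((min h n).toReal : ℝ) : ℂ)‖₊ : ℝ≥0∞) = ‖z‖₊ * min h n := by
  have hfin : min h (n : ℝ≥0∞) ≠ ∞ := ne_top_of_le_ne_top (ENNReal.natCast_ne_top n) (min_le_right _ _)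
  rw [nnnorm_mul, ENNReal.coe_mul]
  congr 1
  change ‖(((min h n).toReal : ℝ) : ℂ)‖ₑ = _
  rw [← ofReal_norm_eq_enorm, Complex.norm_real, Real.norm_of_nonneg ENNReal.toReal_nonneg,
    ENNReal.ofReal_toReal hfin]

lemma trunc_toReal_le (h : ℝ≥0∞) (n : ℕ) : (min h n).toReal ≤ n := by
  have := ENNReal.toReal_mono (ENNReal.natCast_ne_top n) (min_le_right h (n : ℝ≥0∞))
  simpa using this

/-- equivalence of the two formulations of `L^t(Ω)`-valued sparse-form
domination (dualized form and form with the norm inside). -/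
theorem statement18 (d m : ℕ) (hd : 1 ≤ d) (hm : 1 ≤ m)
    (r : Fin m → ℝ≥0∞) (hr : ∀ j, 0 < r j ∧ r j ≠ ∞)
    (q s : ℝ≥0∞) (hq : 0 < q) (hq' : q ≠ ∞) (hqs : q < s)
    (Ω : Type*) [MeasurableSpace Ω] (μ : Measure Ω) [SigmaFinite μ]
    (t : Fin m → ℝ≥0∞) (ht : ∀ j, 0 < t j)
    (hqt : q ≤ (∑ j, (t j)⁻¹)⁻¹) (htfin : (∑ j, (t j)⁻¹)⁻¹ ≠ ∞)
    (f : Fin m → (Fin d → ℝ) → Ω → ℂ)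
    (hf : ∀ j, Measurable (Function.uncurry (f j)))
    (hfloc : ∀ j (Q : Cube d),
      ∫⁻ x in Q.set, (eNorm (t j) μ (nn (f j x))) ^ (r j).toReal < ∞)
    (F : (Fin d → ℝ) → Ω → ℂ) (hF : Measurable (Function.uncurry F))
    (hFt : ∀ᵐ x, eNorm (∑ j, (t j)⁻¹)⁻¹ μ (nn (F x)) ≠ ∞)
    (C : ℝ≥0∞) :
    -- (i) the dualized form of the domination
    (∀ g : (Fin d → ℝ) → Ω → ℂ,
      Measurable (Function.uncurry g) →
      (∃ M : ℝ, ∀ x ω, ‖g x ω‖ ≤ M) →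
      (∃ B : Set (Fin d → ℝ), Bornology.IsBounded B ∧ ∀ x ∉ B, ∀ ω, g x ω = 0) →
      (∀ᵐ x, eNorm (q⁻¹ - ∑ j, (t j)⁻¹)⁻¹ μ (nn (g x)) ≠ ∞) →
      (∫⁻ x, ∫⁻ ω, (‖F x ω‖₊ : ℝ≥0∞) ^ q.toReal * (‖g x ω‖₊ : ℝ≥0∞) ^ q.toReal ∂μ)
          ^ (1 / q.toReal) ≤
        C * eNorm q volume
          (maximalX r (q⁻¹ - s⁻¹)⁻¹ (fun j x => eNorm (t j) μ (nn (f j x)))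
            (fun x => eNorm (q⁻¹ - ∑ j, (t j)⁻¹)⁻¹ μ (nn (g x))))) ↔
    -- (ii) the form with the norm inside
    (∀ g : (Fin d → ℝ) → ℂ, MemLinftyC g →
      eNorm q volume (fun x => eNorm (∑ j, (t j)⁻¹)⁻¹ μ (nn (F x)) * nn g x) ≤
        C * eNorm q volume
          (maximalX r (q⁻¹ - s⁻¹)⁻¹ (fun j x => eNorm (t j) μ (nn (f j x)))
            (nn g))) := by
  set S : ℝ≥0∞ := ∑ j, (t j)⁻¹ with hS
  have hq0 : 0 < q.toReal := ENNReal.toReal_pos hq.ne' hq'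
  have hT0 : S⁻¹ ≠ 0 := (hq.trans_le hqt).ne'
  have hSle : S ≤ q⁻¹ := by
    have := ENNReal.inv_le_inv.2 hqt
    rwa [inv_inv] at this
  have hSne : S ≠ ∞ := by simpa using hT0
  have hS0 : S ≠ 0 := by simpa using htfin
  have hqinv : q⁻¹ ≠ ∞ := by simpa using hq.ne'
  have hUn0 : (q⁻¹ - S)⁻¹ ≠ 0 := by
    rw [ne_eq, ENNReal.inv_eq_zero]
    exact ne_top_of_le_ne_top hqinv tsub_le_self
  have hFm : ∀ x, Measurable (F x) := fun x => hF.of_uncurry_left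
  have hNm := measurable_eNorm μ S⁻¹ F hF
  constructor
  · -- (i) implies (ii)
    rintro hi g ⟨hgm, ⟨M, hM⟩, hgb⟩
    set N : (Fin d → ℝ) → ℝ≥0∞ := fun x => eNorm S⁻¹ μ (nn (F x)) with hN
    set a : ℝ := (S⁻¹.toReal - q.toReal) / q.toReal with ha
    let h : (Fin d → ℝ) → Ω → ℝ≥0∞ := fun x ω => (‖F x ω‖₊ : ℝ≥0∞) ^ a / N x ^ a
    have hqtr : q.toReal ≤ S⁻¹.toReal := ENNReal.toReal_mono htfin hqt
    have hNeq : ∀ x, N x = (∫⁻ ω, (‖F x ω‖₊ : ℝ≥0∞) ^ S⁻¹.toReal ∂μ) ^ (1 / S⁻¹.toReal) := by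
      intro x
      simp only [hN, eNorm, if_neg htfin]
      rfl
    have hFn : Measurable (fun z : (Fin d → ℝ) × Ω => (‖F z.1 z.2‖₊ : ℝ≥0∞)) := hF.enorm
    have hFxn : ∀ x, Measurable (fun ω => (‖F x ω‖₊ : ℝ≥0∞)) := fun x => (hFm x).enorm
    have hhm : Measurable (fun z : (Fin d → ℝ) × Ω => h z.1 z.2) :=
      (hFn.pow_const a).div ((hNm.comp measurable_fst).pow_const a)
    have hgn : Measurable (fun x => (‖g x‖₊ : ℝ≥0∞)) := hgm.enorm
    -- the main identity
    have hmain : ∀ᵐ x, ∫⁻ ω, (((‖F x ω‖₊ : ℝ≥0∞) * ‖g x‖₊) * h x ω) ^ q.toReal ∂μ =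
        (N x * nn g x) ^ q.toReal := by
      filter_upwards [hFt] with x hx
      have hk := key1 μ (fun ω => (‖F x ω‖₊ : ℝ≥0∞)) (hFxn x) q.toReal S⁻¹.toReal hq0 hqtr (N x)
        (hNeq x) hx
      rw [ENNReal.mul_rpow_of_nonneg _ _ hq0.le, ← hk, mul_comm,
        ← lintegral_const_mul' _ _ (by simp [nn, hq0.le])]
      refine lintegral_congr fun ω => ?_
      rw [ENNReal.mul_rpow_of_nonneg _ _ hq0.le, ENNReal.mul_rpow_of_nonneg _ _ hq0.le]
      simp only [h, nn, ha]
      ring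
    -- norm bound
    have hbound : ∀ (n : ℕ) x, eNorm (q⁻¹ - S)⁻¹ μ
        (nn fun ω => g x * (((min (h x ω) n).toReal : ℝ) : ℂ)) ≤ nn g x := by
      intro n x
      rcases eq_or_ne (q⁻¹ - S) 0 with h0 | h0
      · have hSq : S = q⁻¹ := le_antisymm hSle (tsub_eq_zero_iff_le.1 h0)
        have ha0 : a = 0 := by simp [ha, hSq]
        rw [eNorm, if_pos (by simp [h0])]
        refine essSup_le_of_ae_le _ (Filter.Eventually.of_forall fun ω => ?_)
        change (‖_‖₊ : ℝ≥0∞) ≤ _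
        rw [nn_trunc]
        calc (‖g x‖₊ : ℝ≥0∞) * min (h x ω) n ≤ ‖g x‖₊ * 1 := by
              gcongr
              refine (min_le_left _ _).trans ?_
              simp [h, ha0]
          _ = nn g x := by simp [nn]
      · have hUtop : (q⁻¹ - S)⁻¹ ≠ ∞ := by simpa using h0
        have hu0 : 0 < ((q⁻¹ - S)⁻¹).toReal := ENNReal.toReal_pos hUn0 hUtop
        have hueq : ((q⁻¹ - S)⁻¹).toReal = (q.toReal⁻¹ - S.toReal)⁻¹ := by
          rw [ENNReal.toReal_inv, ENNReal.toReal_sub_of_le hSle hqinv, ENNReal.toReal_inv]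
        have hteq : S⁻¹.toReal = S.toReal⁻¹ := ENNReal.toReal_inv S
        have hSpos : 0 < S.toReal := ENNReal.toReal_pos hS0 hSne
        have hpos : 0 < q.toReal⁻¹ - S.toReal := by
          rw [hueq] at hu0; exact inv_pos.1 hu0
        have hlt : q.toReal < S⁻¹.toReal := by
          rw [hteq]
          exact (lt_inv_comm₀ hSpos hq0).1 (by linarith)
        have hk := key2 μ (fun ω => (‖F x ω‖₊ : ℝ≥0∞)) (hFxn x) q.toReal S⁻¹.toReal
          ((q⁻¹ - S)⁻¹).toReal hq0 hlt hu0 (by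
            rw [hueq, hteq]
            have h1 : q.toReal⁻¹ - S.toReal ≠ 0 := hpos.ne'
            rw [← div_eq_mul_inv, div_eq_iff h1]
            field_simp) (N x) (hNeq x)
        rw [eNorm, if_neg hUtop]
        calc (∫⁻ ω, nn (fun ω => g x * (((min (h x ω) n).toReal : ℝ) : ℂ)) ω
                ^ ((q⁻¹ - S)⁻¹).toReal ∂μ) ^ (1 / ((q⁻¹ - S)⁻¹).toReal)
            ≤ (∫⁻ ω, (nn g x) ^ ((q⁻¹ - S)⁻¹).toReal * (h x ω) ^ ((q⁻¹ - S)⁻¹).toReal ∂μ)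
                ^ (1 / ((q⁻¹ - S)⁻¹).toReal) := by
              refine ENNReal.rpow_le_rpow (lintegral_mono fun ω => ?_) (by positivity)
              change (‖_‖₊ : ℝ≥0∞) ^ _ ≤ _
              rw [nn_trunc, ← ENNReal.mul_rpow_of_nonneg _ _ hu0.le]
              refine ENNReal.rpow_le_rpow ?_ hu0.le
              exact mul_le_mul_right (min_le_left _ _) _
          _ ≤ ((nn g x) ^ ((q⁻¹ - S)⁻¹).toReal * 1) ^ (1 / ((q⁻¹ - S)⁻¹).toReal) := by
              refine ENNReal.rpow_le_rpow ?_ (by positivity)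
              rw [lintegral_const_mul' _ _ (by simp [nn, hu0.le])]
              exact mul_le_mul_right hk _
          _ = nn g x := by
              rw [mul_one, ← ENNReal.rpow_mul, mul_one_div_cancel hu0.ne', ENNReal.rpow_one]
    set R := C * eNorm q volume
          (maximalX r (q⁻¹ - s⁻¹)⁻¹ (fun j x => eNorm (t j) μ (nn (f j x))) (nn g)) with hR
    have hn : ∀ n : ℕ, ∫⁻ z : (Fin d → ℝ) × Ω,
        (((‖F z.1 z.2‖₊ : ℝ≥0∞) * ‖g z.1‖₊) * min (h z.1 z.2) n) ^ q.toReal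
          ∂((volume : Measure (Fin d → ℝ)).prod μ) ≤ R ^ q.toReal := by
      intro n
      have hgt : Measurable (Function.uncurry
          (fun x ω => g x * (((min (h x ω) n).toReal : ℝ) : ℂ))) := by
        refine (hgm.comp measurable_fst).mul ?_
        exact Complex.measurable_ofReal.comp (hhm.min measurable_const).ennreal_toReal
      have := hi (fun x ω => g x * (((min (h x ω) n).toReal : ℝ) : ℂ)) hgt
        ⟨M * n, fun x ω => by
          rw [norm_mul, Complex.norm_real, Real.norm_of_nonneg ENNReal.toReal_nonneg]
          exact mul_le_mul (hM x) (trunc_toReal_le _ _) ENNReal.toReal_nonneg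
            ((norm_nonneg _).trans (hM x))⟩
        ⟨Function.support g, hgb, fun x hx ω => by
          rw [Function.notMem_support.1 hx, zero_mul]⟩
        (Filter.Eventually.of_forall fun x =>
          ne_top_of_le_ne_top (by simp [nn]) (hbound n x))
      have h2 := this.trans (mul_le_mul_right (eNorm_mono q volume
        (maximalX_mono r (q⁻¹ - s⁻¹)⁻¹ (fun j x => eNorm (t j) μ (nn (f j x))) (hbound n))) C)
      rw [one_div, ENNReal.rpow_inv_le_iff hq0] at h2
      refine le_trans (le_of_eq ?_) h2
      rw [lintegral_prod _ (by fun_prop)]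
      refine lintegral_congr fun x => lintegral_congr fun ω => ?_
      rw [nn_trunc, mul_assoc, ENNReal.mul_rpow_of_nonneg _ _ hq0.le]
    have h3 := lintegral_trunc_le ((volume : Measure (Fin d → ℝ)).prod μ)
      (fun z => (‖F z.1 z.2‖₊ : ℝ≥0∞) * ‖g z.1‖₊) (fun z => h z.1 z.2)
      (by fun_prop) hhm q.toReal hq0 _ hn
    rw [lintegral_prod _ (by fun_prop), lintegral_congr_ae hmain] at h3
    rw [eNorm, if_neg hq', one_div, ENNReal.rpow_inv_le_iff hq0]
    exact h3
  · -- (ii) implies (i)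
    rintro hii g hgm ⟨M, hM⟩ ⟨B, hB, hgB⟩ hgu
    set G : (Fin d → ℝ) → ℝ≥0∞ := fun x => eNorm (q⁻¹ - S)⁻¹ μ (nn (g x)) with hG
    have hGm : Measurable G := measurable_eNorm μ _ g hgm
    have hGB : ∀ x ∉ B, G x = 0 := by
      intro x hx
      have : g x = fun _ => 0 := funext fun ω => hgB x hx ω
      simp only [hG]
      rw [eNorm_eq_eLpNorm hUn0, this]
      simp
    set R := C * eNorm q volume
          (maximalX r (q⁻¹ - s⁻¹)⁻¹ (fun j x => eNorm (t j) μ (nn (f j x))) G) with hR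
    have hnn : ∀ (n : ℕ) x, nn (fun x => (1 : ℂ) * (((min (G x) n).toReal : ℝ) : ℂ)) x =
        min (G x) n := by
      intro n x
      change (‖_‖₊ : ℝ≥0∞) = _
      rw [nn_trunc]; simp
    have hn : ∀ n : ℕ, ∫⁻ x, (eNorm S⁻¹ μ (nn (F x)) * min (G x) n) ^ q.toReal ≤
        R ^ q.toReal := by
      intro n
      have := hii (fun x => (1 : ℂ) * (((min (G x) n).toReal : ℝ) : ℂ))
        ⟨measurable_const.mul
          (Complex.measurable_ofReal.comp (hGm.min measurable_const).ennreal_toReal),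
         ⟨n, fun x => by
          change ‖(1 : ℂ) * (((min (G x) n).toReal : ℝ) : ℂ)‖ ≤ n
          rw [one_mul, Complex.norm_real, Real.norm_of_nonneg ENNReal.toReal_nonneg]
          exact trunc_toReal_le _ _⟩,
         hB.subset fun x hx => by
          by_contra hxB
          exact hx (by simp [hGB x hxB])⟩
      have h2 := this.trans (mul_le_mul_right (eNorm_mono q volume
        (maximalX_mono r (q⁻¹ - s⁻¹)⁻¹ (fun j x => eNorm (t j) μ (nn (f j x)))
          (fun x => (hnn n x).le.trans (min_le_left _ _)))) C)
      rw [eNorm, if_neg hq', one_div, ENNReal.rpow_inv_le_iff hq0] at h2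
      simp_rw [hnn] at h2
      exact h2
    have h3 := lintegral_trunc_le volume _ G hNm hGm q.toReal hq0 _ hn
    rw [one_div, ENNReal.rpow_inv_le_iff hq0]
    refine (lintegral_mono fun x => ?_).trans h3
    refine holder_aux μ q S⁻¹ (q⁻¹ - S)⁻¹ hq.ne' hq' hT0 hUn0 ?_ (F x) (g x) (hFm x)
      hgm.of_uncurry_left
    rw [inv_inv, inv_inv, add_tsub_cancel_of_le hSle]

end
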